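/- arXiv:1407.5972 — 6 statements merged into one kernel-verified Lean document; each statement's English description precedes it below -/
import Mathlib

section
/- For every smooth a : ℝ → ℝ, the vector field X^R_3 on ℝ⁴ with components X^0 = 0, X^1 = cos(φ₁−φ₂), X^2 = −cot(η)·sin(φ₁−φ₂), X^3 = −tan(η)·sin(φ₁−φ₂) is a Killing vector field for the Robertson–Walker metric g on U. -/
open Real

/-- Partial derivative with respect to the `k`-th coordinate on `ℝ⁴`. -/
noncomputable def pderiv4 (k : Fin 4) (f : (Fin 4 → ℝ) → ℝ) (x : Fin 4 → ℝ) : ℝ :=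
  fderiv ℝ f x (Pi.single k 1)

/-- The Robertson–Walker metric in Hopf coordinates `(t, η, φ₁, φ₂)`:
`g = dt² + a(t)²(dη² + sin²η dφ₁² + cos²η dφ₂²)`. -/
noncomputable def gRW (a : ℝ → ℝ) (i j : Fin 4) (x : Fin 4 → ℝ) : ℝ :=
  if i = j then
    (if i = 0 then 1
     else if i = 1 then a (x 0) ^ 2
     else if i = 2 then a (x 0) ^ 2 * Real.sin (x 1) ^ 2
     else a (x 0) ^ 2 * Real.cos (x 1) ^ 2)
  else 0

/-- `X` is a Killing vector field for the Robertson–Walker metric on the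
open set `U = {0 < η < π/2}`: the Lie derivative of `g` along `X` vanishes. -/
def IsKillingRW (a : ℝ → ℝ) (X : Fin 4 → (Fin 4 → ℝ) → ℝ) : Prop :=
  ∀ i j : Fin 4, ∀ x : Fin 4 → ℝ, 0 < x 1 → x 1 < Real.pi / 2 →
    (∑ k : Fin 4, X k x * pderiv4 k (gRW a i j) x)
      + (∑ k : Fin 4, gRW a i k x * pderiv4 j (X k) x)
      + (∑ k : Fin 4, gRW a k j x * pderiv4 i (X k) x) = 0

theorem pderiv4_eq_of_hasFDerivAt {f : (Fin 4 → ℝ) → ℝ} {f' : (Fin 4 → ℝ) →L[ℝ] ℝ}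
    {x : Fin 4 → ℝ} (h : HasFDerivAt f f' x) (k : Fin 4) :
    pderiv4 k f x = f' (Pi.single k 1) := by
  rw [pderiv4, h.fderiv]

theorem pderiv4_const (k : Fin 4) (c : ℝ) (x : Fin 4 → ℝ) :
    pderiv4 k (fun _ => c) x = 0 := by
  simp [pderiv4]

/-- Partial derivatives of a product of functions of one coordinate each. -/
theorem pderiv4_mul_coord {u v : ℝ → ℝ} {u' v' : ℝ} {x : Fin 4 → ℝ} {i j : Fin 4}
    (hu : HasDerivAt u u' (x i)) (hv : HasDerivAt v v' (x j)) (k : Fin 4) :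
    pderiv4 k (fun y => u (y i) * v (y j)) x =
      (if i = k then u' * v (x j) else 0) + (if j = k then u (x i) * v' else 0) := by
  have hi := hu.comp_hasFDerivAt x (hasFDerivAt_apply (𝕜 := ℝ) i x)
  have hj := hv.comp_hasFDerivAt x (hasFDerivAt_apply (𝕜 := ℝ) j x)
  refine (pderiv4_eq_of_hasFDerivAt (hi.mul hj) k).trans ?_
  simp [Pi.single_apply]
  split_ifs <;> ring

/-- Partial derivatives of a function of `x 1` times a function of `x 2 - x 3`. -/
theorem pderiv4_mul_sub {u v : ℝ → ℝ} {u' v' : ℝ} {x : Fin 4 → ℝ}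
    (hu : HasDerivAt u u' (x 1)) (hv : HasDerivAt v v' (x 2 - x 3)) (k : Fin 4) :
    pderiv4 k (fun y => u (y 1) * v (y 2 - y 3)) x =
      (if k = 1 then u' * v (x 2 - x 3) else 0) + (if k = 2 then u (x 1) * v' else 0)
        - (if k = 3 then u (x 1) * v' else 0) := by
  have h₁ := hu.comp_hasFDerivAt x (hasFDerivAt_apply (𝕜 := ℝ) 1 x)
  have h₂ := hv.comp_hasFDerivAt x
    ((hasFDerivAt_apply (𝕜 := ℝ) 2 x).sub (hasFDerivAt_apply (𝕜 := ℝ) 3 x))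
  refine (pderiv4_eq_of_hasFDerivAt (h₁.mul h₂) k).trans ?_
  fin_cases k <;> simp; ring

theorem XR3_isKilling (a : ℝ → ℝ) (ha : ContDiff ℝ (⊤ : ℕ∞) a) :
    IsKillingRW a (fun k x =>
      if k = 0 then 0
      else if k = 1 then Real.cos (x 2 - x 3)
      else if k = 2 then -((Real.cos (x 1) / Real.sin (x 1)) * Real.sin (x 2 - x 3))
      else -(Real.tan (x 1) * Real.sin (x 2 - x 3))) := by
  intro i j x h0 h1
  have hs : Real.sin (x 1) ≠ 0 := (Real.sin_pos_of_pos_of_lt_pi h0 (by linarith [Real.pi_pos])).ne'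
  have hc : Real.cos (x 1) ≠ 0 := (Real.cos_pos_of_mem_Ioo ⟨by linarith, h1⟩).ne'
  have hsc : -Real.sin (x 1) * Real.sin (x 1) - Real.cos (x 1) * Real.cos (x 1) = -1 := by
    linear_combination -Real.sin_sq_add_cos_sq (x 1)
  have hA := ((ha.differentiable (by simp)) (x 0)).hasDerivAt.pow 2
  have hX1 := pderiv4_mul_sub (hasDerivAt_const (x 1) (1 : ℝ)) (Real.hasDerivAt_cos (x 2 - x 3))
  have hX2 := pderiv4_mul_sub
    ((Real.hasDerivAt_cos (x 1)).div (Real.hasDerivAt_sin (x 1)) hs).neg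
    (Real.hasDerivAt_sin (x 2 - x 3))
  have hX3 := pderiv4_mul_sub (Real.hasDerivAt_tan hc).neg (Real.hasDerivAt_sin (x 2 - x 3))
  have hg1 := pderiv4_mul_coord hA (hasDerivAt_const (x 1) (1 : ℝ))
  have hg2 := pderiv4_mul_coord hA ((Real.hasDerivAt_sin (x 1)).pow 2)
  have hg3 := pderiv4_mul_coord hA ((Real.hasDerivAt_cos (x 1)).pow 2)
  rw [hsc] at hX2
  simp only [Pi.neg_apply, Pi.div_apply, Pi.pow_apply, one_mul, mul_one, neg_mul]
    at hX1 hX2 hX3 hg1 hg2 hg3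
  unfold gRW
  fin_cases i <;> fin_cases j <;>
    simp [Fin.sum_univ_four, hX1, hX2, hX3, hg1, hg2, hg3, pderiv4_const]
  all_goals
    try rw [Real.tan_eq_sin_div_cos]
    field_simp
    ring
end

section
/- Let a = sin : ℝ → ℝ. Then for every t ∈ (0, π): −(1/(10080·a(t)⁴))·(−a^(8)(t)·a(t)⁶ + 3·a^(6)(t)·a(t)⁴ + 13·a^(4)(t)²·a(t)⁵ − 24·a^(3)(t)²·a(t)³ − 114·a(t)³·a''(t)⁴ + 43·a(t)²·a''(t)³ − 5·a^(7)(t)·a(t)⁵·a'(t) + 2·a^(6)(t)·a(t)⁵·a''(t) + 9·a^(6)(t)·a(t)⁴·a'(t)² + 16·a^(3)(t)·a^(5)(t)·a(t)⁵ − 24·a^(5)(t)·a(t)³·a'(t)³ − 6·a^(5)(t)·a(t)³·a'(t) + 69·a^(4)(t)·a(t)⁴·a''(t)² − 36·a^(4)(t)·a(t)³·a''(t) + 60·a^(4)(t)·a(t)²·a'(t)⁴ + 15·a^(4)(t)·a(t)²·a'(t)² + 90·a^(3)(t)²·a(t)⁴·a''(t) − 216·a^(3)(t)²·a(t)³·a'(t)²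 − 108·a^(3)(t)·a(t)·a'(t)⁵ − 27·a^(3)(t)·a(t)·a'(t)³ + 801·a(t)²·a'(t)²·a''(t)³ − 588·a(t)·a'(t)⁴·a''(t)² − 87·a(t)·a'(t)²·a''(t)² + 108·a'(t)⁶·a''(t) + 27·a'(t)⁴·a''(t) + 78·a^(5)(t)·a(t)⁴·a'(t)·a''(t) + 132·a^(3)(t)·a^(4)(t)·a(t)⁴·a'(t) − 312·a^(4)(t)·a(t)³·a'(t)²·a''(t) − 819·a^(3)(t)·a(t)³·a'(t)·a''(t)² + 768·a^(3)(t)·a(t)²·a'(t)³·a''(t) + 102·a^(3)(t)·a(t)²·a'(t)·a''(t)) = (41/10080)·sin(t)³. (This is the reduction to the round case a(t) = sin t of the heat coefficient a_8(t) of the Robertson–Walker metric, consistent with the round sphere expansion of Chamseddine–Connes.) -/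
open Real

/-- The `k`-th derivative of the round scale factor `a = sin`. -/
noncomputable def dsin (k : ℕ) (t : ℝ) : ℝ := iteratedDeriv k Real.sin t

theorem dsin_zero (t : ℝ) : dsin 0 t = Real.sin t := by
  simp [dsin]

theorem dsin_one (t : ℝ) : dsin 1 t = Real.cos t := by
  simp [dsin]

theorem dsin_add_two (k : ℕ) (t : ℝ) : dsin (k + 2) t = -dsin k t := by
  have h : deriv (deriv Real.sin) = -Real.sin := by
    ext x
    simp
  simp only [dsin]
  rw [iteratedDeriv_succ', iteratedDeriv_succ', h, iteratedDeriv_neg]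

/-- Reduction of the heat coefficient of the Robertson–Walker metric to the round
case `a(t) = sin t`. -/
theorem a8_round (t : ℝ) (ht0 : 0 < t) (ht1 : t < Real.pi) :
    -(1/(10080 * (dsin 0 t)^4)) * (-(dsin 8 t) * (dsin 0 t)^6 + 3 * (dsin 6 t) * (dsin 0 t)^4 +
      13 * (dsin 4 t)^2 * (dsin 0 t)^5 - 24 * (dsin 3 t)^2 * (dsin 0 t)^3 - 114 * (dsin 0 t)^3
      * (dsin 2 t)^4 + 43 * (dsin 0 t)^2 * (dsin 2 t)^3 - 5 * (dsin 7 t) * (dsin 0 t)^5 * (dsin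
      1 t) + 2 * (dsin 6 t) * (dsin 0 t)^5 * (dsin 2 t) + 9 * (dsin 6 t) * (dsin 0 t)^4 * (dsin
      1 t)^2 + 16 * (dsin 3 t) * (dsin 5 t) * (dsin 0 t)^5 - 24 * (dsin 5 t) * (dsin 0 t)^3 *
      (dsin 1 t)^3 - 6 * (dsin 5 t) * (dsin 0 t)^3 * (dsin 1 t) + 69 * (dsin 4 t) * (dsin 0
      t)^4 * (dsin 2 t)^2 - 36 * (dsin 4 t) * (dsin 0 t)^3 * (dsin 2 t) + 60 * (dsin 4 t) *
      (dsin 0 t)^2 * (dsin 1 t)^4 + 15 * (dsin 4 t) * (dsin 0 t)^2 * (dsin 1 t)^2 + 90 * (dsin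
      3 t)^2 * (dsin 0 t)^4 * (dsin 2 t) - 216 * (dsin 3 t)^2 * (dsin 0 t)^3 * (dsin 1 t)^2 -
      108 * (dsin 3 t) * (dsin 0 t) * (dsin 1 t)^5 - 27 * (dsin 3 t) * (dsin 0 t) * (dsin 1
      t)^3 + 801 * (dsin 0 t)^2 * (dsin 1 t)^2 * (dsin 2 t)^3 - 588 * (dsin 0 t) * (dsin 1 t)^4
      * (dsin 2 t)^2 - 87 * (dsin 0 t) * (dsin 1 t)^2 * (dsin 2 t)^2 + 108 * (dsin 1 t)^6 *
      (dsin 2 t) + 27 * (dsin 1 t)^4 * (dsin 2 t) + 78 * (dsin 5 t) * (dsin 0 t)^4 * (dsin 1 t)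
      * (dsin 2 t) + 132 * (dsin 3 t) * (dsin 4 t) * (dsin 0 t)^4 * (dsin 1 t) - 312 * (dsin 4
      t) * (dsin 0 t)^3 * (dsin 1 t)^2 * (dsin 2 t) - 819 * (dsin 3 t) * (dsin 0 t)^3 * (dsin 1
      t) * (dsin 2 t)^2 + 768 * (dsin 3 t) * (dsin 0 t)^2 * (dsin 1 t)^3 * (dsin 2 t) + 102 *
      (dsin 3 t) * (dsin 0 t)^2 * (dsin 1 t) * (dsin 2 t))
      = (41 / 10080) * Real.sin t ^ 3 := by
  have hs : Real.sin t ≠ 0 := (Real.sin_pos_of_pos_of_lt_pi ht0 ht1).ne'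
  have hc : Real.cos t ^ 2 = 1 - Real.sin t ^ 2 := Real.cos_sq' t
  simp only [dsin_add_two 0, dsin_add_two 1, dsin_add_two 2, dsin_add_two 3, dsin_add_two 4,
    dsin_add_two 5, dsin_add_two 6, dsin_zero, dsin_one]
  generalize Real.sin t = s at *
  generalize Real.cos t = c at *
  field_simp
  grind
end

section
/- Let a = sin : ℝ → ℝ. Then for every t ∈ (0, π): (1/(17297280·a(t)⁸))·(3·a^(12)(t)·a(t)¹⁰ − 1057·a^(6)(t)²·a(t)⁹ − 1747·a^(5)(t)·a^(7)(t)·a(t)⁹ − 970·a^(4)(t)·a^(8)(t)·a(t)⁹ − 317·a^(3)(t)·a^(9)(t)·a(t)⁹ − 34·a''(t)·a^(10)(t)·a(t)⁹ + 21·a'(t)·a^(11)(t)·a(t)⁹ + 5001·a^(4)(t)³·a(t)⁸ + 2419·a''(t)·a^(5)(t)²·a(t)⁸ + 19174·a^(3)(t)·a^(4)(t)·a^(5)(t)·a(t)⁸ + 4086·a^(3)(t)²·a^(6)(t)·a(t)⁸ + 2970·a''(t)·a^(4)(t)·a^(6)(t)·a(t)⁸ − 5520·a'(t)·a^(5)(t)·a^(6)(t)·a(t)⁸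 − 511·a''(t)·a^(3)(t)·a^(7)(t)·a(t)⁸ − 4175·a'(t)·a^(4)(t)·a^(7)(t)·a(t)⁸ − 745·a''(t)²·a^(8)(t)·a(t)⁸ − 2289·a'(t)·a^(3)(t)·a^(8)(t)·a(t)⁸ − 828·a'(t)·a''(t)·a^(9)(t)·a(t)⁸ − 62·a'(t)²·a^(10)(t)·a(t)⁸ − 13·a^(10)(t)·a(t)⁸ + 45480·a^(3)(t)⁴·a(t)⁷ + 152962·a''(t)²·a^(4)(t)²·a(t)⁷ + 203971·a'(t)·a^(3)(t)·a^(4)(t)²·a(t)⁷ + 21369·a'(t)²·a^(5)(t)²·a(t)⁷ + 1885·a^(5)(t)²·a(t)⁷ + 410230·a''(t)·a^(3)(t)²·a^(4)(t)·a(t)⁷ + 163832·a'(t)·a^(3)(t)²·a^(5)(t)·a(t)⁷ + 250584·a''(t)²·a^(3)(t)·a^(5)(t)·a(t)⁷ + 244006·a'(t)·a''(t)·a^(4)(t)·a^(5)(t)·a(t)⁷ + 42440·a''(t)³·a^(6)(t)·a(t)⁷ + 163390·a'(t)·a''(t)·a^(3)(t)·a^(6)(t)·a(t)⁷ + 35550·a'(t)²·a^(4)(t)·a^(6)(t)·a(t)⁷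 + 3094·a^(4)(t)·a^(6)(t)·a(t)⁷ + 34351·a'(t)·a''(t)²·a^(7)(t)·a(t)⁷ + 19733·a'(t)²·a^(3)(t)·a^(7)(t)·a(t)⁷ + 1625·a^(3)(t)·a^(7)(t)·a(t)⁷ + 6784·a'(t)²·a''(t)·a^(8)(t)·a(t)⁷ + 520·a''(t)·a^(8)(t)·a(t)⁷ + 308·a'(t)³·a^(9)(t)·a(t)⁷ + 52·a'(t)·a^(9)(t)·a(t)⁷ − 2056720·a'(t)·a''(t)·a^(3)(t)³·a(t)⁶ − 1790580·a''(t)³·a^(3)(t)²·a(t)⁶ − 900272·a'(t)²·a''(t)·a^(4)(t)²·a(t)⁶ − 31889·a''(t)·a^(4)(t)²·a(t)⁶ − 643407·a''(t)⁴·a^(4)(t)·a(t)⁶ − 1251548·a'(t)²·a^(3)(t)²·a^(4)(t)·a(t)⁶ − 43758·a^(3)(t)²·a^(4)(t)·a(t)⁶ − 4452042·a'(t)·a''(t)²·a^(3)(t)·a^(4)(t)·a(t)⁶ − 836214·a'(t)·a''(t)³·a^(5)(t)·a(t)⁶ − 1400104·a'(t)²·a''(t)·a^(3)(t)·a^(5)(t)·a(t)⁶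 − 48620·a''(t)·a^(3)(t)·a^(5)(t)·a(t)⁶ − 181966·a'(t)³·a^(4)(t)·a^(5)(t)·a(t)⁶ − 18018·a'(t)·a^(4)(t)·a^(5)(t)·a(t)⁶ − 319996·a'(t)²·a''(t)²·a^(6)(t)·a(t)⁶ − 11011·a''(t)²·a^(6)(t)·a(t)⁶ − 115062·a'(t)³·a^(3)(t)·a^(6)(t)·a(t)⁶ − 11154·a'(t)·a^(3)(t)·a^(6)(t)·a(t)⁶ − 42764·a'(t)³·a''(t)·a^(7)(t)·a(t)⁶ − 4004·a'(t)·a''(t)·a^(7)(t)·a(t)⁶ − 1649·a'(t)⁴·a^(8)(t)·a(t)⁶ − 286·a'(t)²·a^(8)(t)·a(t)⁶ + 460769·a''(t)⁶·a(t)⁵ + 1661518·a'(t)³·a^(3)(t)³·a(t)⁵ + 83486·a'(t)·a^(3)(t)³·a(t)⁵ + 13383328·a'(t)²·a''(t)²·a^(3)(t)²·a(t)⁵ + 222092·a''(t)²·a^(3)(t)²·a(t)⁵ + 342883·a'(t)⁴·a^(4)(t)²·a(t)⁵ + 36218·a'(t)²·a^(4)(t)²·a(t)⁵ + 7922361·a'(t)·a''(t)⁴·a^(3)(t)·a(t)⁵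 + 6367314·a'(t)²·a''(t)³·a^(4)(t)·a(t)⁵ + 109330·a''(t)³·a^(4)(t)·a(t)⁵ + 7065862·a'(t)³·a''(t)·a^(3)(t)·a^(4)(t)·a(t)⁵ + 360386·a'(t)·a''(t)·a^(3)(t)·a^(4)(t)·a(t)⁵ + 1918386·a'(t)³·a''(t)²·a^(5)(t)·a(t)⁵ + 98592·a'(t)·a''(t)²·a^(5)(t)·a(t)⁵ + 524802·a'(t)⁴·a^(3)(t)·a^(5)(t)·a(t)⁵ + 55146·a'(t)²·a^(3)(t)·a^(5)(t)·a(t)⁵ + 226014·a'(t)⁴·a''(t)·a^(6)(t)·a(t)⁵ + 23712·a'(t)²·a''(t)·a^(6)(t)·a(t)⁵ + 8283·a'(t)⁵·a^(7)(t)·a(t)⁵ + 1482·a'(t)³·a^(7)(t)·a(t)⁵ − 7346958·a'(t)²·a''(t)⁵·a(t)⁴ − 72761·a''(t)⁵·a(t)⁴ − 11745252·a'(t)⁴·a''(t)·a^(3)(t)²·a(t)⁴ − 725712·a'(t)²·a''(t)·a^(3)(t)²·a(t)⁴ − 27707028·a'(t)³·a''(t)³·a^(3)(t)·a(t)⁴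 − 819520·a'(t)·a''(t)³·a^(3)(t)·a(t)⁴ − 8247105·a'(t)⁴·a''(t)²·a^(4)(t)·a(t)⁴ − 520260·a'(t)²·a''(t)²·a^(4)(t)·a(t)⁴ − 1848228·a'(t)⁵·a^(3)(t)·a^(4)(t)·a(t)⁴ − 205296·a'(t)³·a^(3)(t)·a^(4)(t)·a(t)⁴ − 973482·a'(t)⁵·a''(t)·a^(5)(t)·a(t)⁴ − 110136·a'(t)³·a''(t)·a^(5)(t)·a(t)⁴ − 36723·a'(t)⁶·a^(6)(t)·a(t)⁴ − 6747·a'(t)⁴·a^(6)(t)·a(t)⁴ + 17816751·a'(t)⁴·a''(t)⁴·a(t)³ + 721058·a'(t)²·a''(t)⁴·a(t)³ + 2352624·a'(t)⁶·a^(3)(t)²·a(t)³ + 274170·a'(t)⁴·a^(3)(t)²·a(t)³ + 24583191·a'(t)⁵·a''(t)²·a^(3)(t)·a(t)³ + 1771146·a'(t)³·a''(t)²·a^(3)(t)·a(t)³ + 3256248·a'(t)⁶·a''(t)·a^(4)(t)·a(t)³ + 389376·a'(t)⁴·a''(t)·a^(4)(t)·a(t)³ + 135300·a'(t)⁷·a^(5)(t)·a(t)³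 + 25350·a'(t)⁵·a^(5)(t)·a(t)³ − 15430357·a'(t)⁶·a''(t)³·a(t)² − 1252745·a'(t)⁴·a''(t)³·a(t)² − 7747848·a'(t)⁷·a''(t)·a^(3)(t)·a(t)² − 967590·a'(t)⁵·a''(t)·a^(3)(t)·a(t)² − 385200·a'(t)⁸·a^(4)(t)·a(t)² − 73125·a'(t)⁶·a^(4)(t)·a(t)² + 5645124·a'(t)⁸·a''(t)²·a(t) + 741195·a'(t)⁶·a''(t)²·a(t) + 749700·a'(t)⁹·a^(3)(t)·a(t) + 143325·a'(t)⁷·a^(3)(t)·a(t) − 749700·a'(t)¹⁰·a''(t) − 143325·a'(t)⁸·a''(t)) = (10331/8648640)·sin(t)³. (This is the paper's verification that its expression for the heat coefficient a_12(t) of the Robertson–Walker metric reduces, for the round metric a(t) = sin t, to 10331·sin³(t)/8648640.) -/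
open Real

set_option maxHeartbeats 2000000 in
/-- Reduction of the heat coefficient of the Robertson–Walker metric to the round
case `a(t) = sin t`. -/
theorem a12_round (t : ℝ) (ht0 : 0 < t) (ht1 : t < Real.pi) :
    (1/(17297280 * (dsin 0 t)^8)) * (3 * (dsin 12 t) * (dsin 0 t)^10 - 1057 * (dsin 6 t)^2 *
      (dsin 0 t)^9 - 1747 * (dsin 5 t) * (dsin 7 t) * (dsin 0 t)^9 - 970 * (dsin 4 t) * (dsin 8
      t) * (dsin 0 t)^9 - 317 * (dsin 3 t) * (dsin 9 t) * (dsin 0 t)^9 - 34 * (dsin 2 t) *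
      (dsin 10 t) * (dsin 0 t)^9 + 21 * (dsin 1 t) * (dsin 11 t) * (dsin 0 t)^9 + 5001 * (dsin
      4 t)^3 * (dsin 0 t)^8 + 2419 * (dsin 2 t) * (dsin 5 t)^2 * (dsin 0 t)^8 + 19174 * (dsin 3
      t) * (dsin 4 t) * (dsin 5 t) * (dsin 0 t)^8 + 4086 * (dsin 3 t)^2 * (dsin 6 t) * (dsin 0
      t)^8 + 2970 * (dsin 2 t) * (dsin 4 t) * (dsin 6 t) * (dsin 0 t)^8 - 5520 * (dsin 1 t) *
      (dsin 5 t) * (dsin 6 t) * (dsin 0 t)^8 - 511 * (dsin 2 t) * (dsin 3 t) * (dsin 7 t) *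
      (dsin 0 t)^8 - 4175 * (dsin 1 t) * (dsin 4 t) * (dsin 7 t) * (dsin 0 t)^8 - 745 * (dsin 2
      t)^2 * (dsin 8 t) * (dsin 0 t)^8 - 2289 * (dsin 1 t) * (dsin 3 t) * (dsin 8 t) * (dsin 0
      t)^8 - 828 * (dsin 1 t) * (dsin 2 t) * (dsin 9 t) * (dsin 0 t)^8 - 62 * (dsin 1 t)^2 *
      (dsin 10 t) * (dsin 0 t)^8 - 13 * (dsin 10 t) * (dsin 0 t)^8 + 45480 * (dsin 3 t)^4 *
      (dsin 0 t)^7 + 152962 * (dsin 2 t)^2 * (dsin 4 t)^2 * (dsin 0 t)^7 + 203971 * (dsin 1 t)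
      * (dsin 3 t) * (dsin 4 t)^2 * (dsin 0 t)^7 + 21369 * (dsin 1 t)^2 * (dsin 5 t)^2 * (dsin
      0 t)^7 + 1885 * (dsin 5 t)^2 * (dsin 0 t)^7 + 410230 * (dsin 2 t) * (dsin 3 t)^2 * (dsin
      4 t) * (dsin 0 t)^7 + 163832 * (dsin 1 t) * (dsin 3 t)^2 * (dsin 5 t) * (dsin 0 t)^7 +
      250584 * (dsin 2 t)^2 * (dsin 3 t) * (dsin 5 t) * (dsin 0 t)^7 + 244006 * (dsin 1 t) *
      (dsin 2 t) * (dsin 4 t) * (dsin 5 t) * (dsin 0 t)^7 + 42440 * (dsin 2 t)^3 * (dsin 6 t) *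
      (dsin 0 t)^7 + 163390 * (dsin 1 t) * (dsin 2 t) * (dsin 3 t) * (dsin 6 t) * (dsin 0 t)^7
      + 35550 * (dsin 1 t)^2 * (dsin 4 t) * (dsin 6 t) * (dsin 0 t)^7 + 3094 * (dsin 4 t) *
      (dsin 6 t) * (dsin 0 t)^7 + 34351 * (dsin 1 t) * (dsin 2 t)^2 * (dsin 7 t) * (dsin 0 t)^7
      + 19733 * (dsin 1 t)^2 * (dsin 3 t) * (dsin 7 t) * (dsin 0 t)^7 + 1625 * (dsin 3 t) *
      (dsin 7 t) * (dsin 0 t)^7 + 6784 * (dsin 1 t)^2 * (dsin 2 t) * (dsin 8 t) * (dsin 0 t)^7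
      + 520 * (dsin 2 t) * (dsin 8 t) * (dsin 0 t)^7 + 308 * (dsin 1 t)^3 * (dsin 9 t) * (dsin
      0 t)^7 + 52 * (dsin 1 t) * (dsin 9 t) * (dsin 0 t)^7 - 2056720 * (dsin 1 t) * (dsin 2 t)
      * (dsin 3 t)^3 * (dsin 0 t)^6 - 1790580 * (dsin 2 t)^3 * (dsin 3 t)^2 * (dsin 0 t)^6 -
      900272 * (dsin 1 t)^2 * (dsin 2 t) * (dsin 4 t)^2 * (dsin 0 t)^6 - 31889 * (dsin 2 t) *
      (dsin 4 t)^2 * (dsin 0 t)^6 - 643407 * (dsin 2 t)^4 * (dsin 4 t) * (dsin 0 t)^6 - 1251548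
      * (dsin 1 t)^2 * (dsin 3 t)^2 * (dsin 4 t) * (dsin 0 t)^6 - 43758 * (dsin 3 t)^2 * (dsin
      4 t) * (dsin 0 t)^6 - 4452042 * (dsin 1 t) * (dsin 2 t)^2 * (dsin 3 t) * (dsin 4 t) *
      (dsin 0 t)^6 - 836214 * (dsin 1 t) * (dsin 2 t)^3 * (dsin 5 t) * (dsin 0 t)^6 - 1400104 *
      (dsin 1 t)^2 * (dsin 2 t) * (dsin 3 t) * (dsin 5 t) * (dsin 0 t)^6 - 48620 * (dsin 2 t) *
      (dsin 3 t) * (dsin 5 t) * (dsin 0 t)^6 - 181966 * (dsin 1 t)^3 * (dsin 4 t) * (dsin 5 t)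
      * (dsin 0 t)^6 - 18018 * (dsin 1 t) * (dsin 4 t) * (dsin 5 t) * (dsin 0 t)^6 - 319996 *
      (dsin 1 t)^2 * (dsin 2 t)^2 * (dsin 6 t) * (dsin 0 t)^6 - 11011 * (dsin 2 t)^2 * (dsin 6
      t) * (dsin 0 t)^6 - 115062 * (dsin 1 t)^3 * (dsin 3 t) * (dsin 6 t) * (dsin 0 t)^6 -
      11154 * (dsin 1 t) * (dsin 3 t) * (dsin 6 t) * (dsin 0 t)^6 - 42764 * (dsin 1 t)^3 *
      (dsin 2 t) * (dsin 7 t) * (dsin 0 t)^6 - 4004 * (dsin 1 t) * (dsin 2 t) * (dsin 7 t) *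
      (dsin 0 t)^6 - 1649 * (dsin 1 t)^4 * (dsin 8 t) * (dsin 0 t)^6 - 286 * (dsin 1 t)^2 *
      (dsin 8 t) * (dsin 0 t)^6 + 460769 * (dsin 2 t)^6 * (dsin 0 t)^5 + 1661518 * (dsin 1 t)^3
      * (dsin 3 t)^3 * (dsin 0 t)^5 + 83486 * (dsin 1 t) * (dsin 3 t)^3 * (dsin 0 t)^5 +
      13383328 * (dsin 1 t)^2 * (dsin 2 t)^2 * (dsin 3 t)^2 * (dsin 0 t)^5 + 222092 * (dsin 2
      t)^2 * (dsin 3 t)^2 * (dsin 0 t)^5 + 342883 * (dsin 1 t)^4 * (dsin 4 t)^2 * (dsin 0 t)^5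
      + 36218 * (dsin 1 t)^2 * (dsin 4 t)^2 * (dsin 0 t)^5 + 7922361 * (dsin 1 t) * (dsin 2
      t)^4 * (dsin 3 t) * (dsin 0 t)^5 + 6367314 * (dsin 1 t)^2 * (dsin 2 t)^3 * (dsin 4 t) *
      (dsin 0 t)^5 + 109330 * (dsin 2 t)^3 * (dsin 4 t) * (dsin 0 t)^5 + 7065862 * (dsin 1 t)^3
      * (dsin 2 t) * (dsin 3 t) * (dsin 4 t) * (dsin 0 t)^5 + 360386 * (dsin 1 t) * (dsin 2 t)
      * (dsin 3 t) * (dsin 4 t) * (dsin 0 t)^5 + 1918386 * (dsin 1 t)^3 * (dsin 2 t)^2 * (dsin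
      5 t) * (dsin 0 t)^5 + 98592 * (dsin 1 t) * (dsin 2 t)^2 * (dsin 5 t) * (dsin 0 t)^5 +
      524802 * (dsin 1 t)^4 * (dsin 3 t) * (dsin 5 t) * (dsin 0 t)^5 + 55146 * (dsin 1 t)^2 *
      (dsin 3 t) * (dsin 5 t) * (dsin 0 t)^5 + 226014 * (dsin 1 t)^4 * (dsin 2 t) * (dsin 6 t)
      * (dsin 0 t)^5 + 23712 * (dsin 1 t)^2 * (dsin 2 t) * (dsin 6 t) * (dsin 0 t)^5 + 8283 *
      (dsin 1 t)^5 * (dsin 7 t) * (dsin 0 t)^5 + 1482 * (dsin 1 t)^3 * (dsin 7 t) * (dsin 0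
      t)^5 - 7346958 * (dsin 1 t)^2 * (dsin 2 t)^5 * (dsin 0 t)^4 - 72761 * (dsin 2 t)^5 *
      (dsin 0 t)^4 - 11745252 * (dsin 1 t)^4 * (dsin 2 t) * (dsin 3 t)^2 * (dsin 0 t)^4 -
      725712 * (dsin 1 t)^2 * (dsin 2 t) * (dsin 3 t)^2 * (dsin 0 t)^4 - 27707028 * (dsin 1
      t)^3 * (dsin 2 t)^3 * (dsin 3 t) * (dsin 0 t)^4 - 819520 * (dsin 1 t) * (dsin 2 t)^3 *
      (dsin 3 t) * (dsin 0 t)^4 - 8247105 * (dsin 1 t)^4 * (dsin 2 t)^2 * (dsin 4 t) * (dsin 0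
      t)^4 - 520260 * (dsin 1 t)^2 * (dsin 2 t)^2 * (dsin 4 t) * (dsin 0 t)^4 - 1848228 * (dsin
      1 t)^5 * (dsin 3 t) * (dsin 4 t) * (dsin 0 t)^4 - 205296 * (dsin 1 t)^3 * (dsin 3 t) *
      (dsin 4 t) * (dsin 0 t)^4 - 973482 * (dsin 1 t)^5 * (dsin 2 t) * (dsin 5 t) * (dsin 0
      t)^4 - 110136 * (dsin 1 t)^3 * (dsin 2 t) * (dsin 5 t) * (dsin 0 t)^4 - 36723 * (dsin 1
      t)^6 * (dsin 6 t) * (dsin 0 t)^4 - 6747 * (dsin 1 t)^4 * (dsin 6 t) * (dsin 0 t)^4 +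
      17816751 * (dsin 1 t)^4 * (dsin 2 t)^4 * (dsin 0 t)^3 + 721058 * (dsin 1 t)^2 * (dsin 2
      t)^4 * (dsin 0 t)^3 + 2352624 * (dsin 1 t)^6 * (dsin 3 t)^2 * (dsin 0 t)^3 + 274170 *
      (dsin 1 t)^4 * (dsin 3 t)^2 * (dsin 0 t)^3 + 24583191 * (dsin 1 t)^5 * (dsin 2 t)^2 *
      (dsin 3 t) * (dsin 0 t)^3 + 1771146 * (dsin 1 t)^3 * (dsin 2 t)^2 * (dsin 3 t) * (dsin 0
      t)^3 + 3256248 * (dsin 1 t)^6 * (dsin 2 t) * (dsin 4 t) * (dsin 0 t)^3 + 389376 * (dsin 1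
      t)^4 * (dsin 2 t) * (dsin 4 t) * (dsin 0 t)^3 + 135300 * (dsin 1 t)^7 * (dsin 5 t) *
      (dsin 0 t)^3 + 25350 * (dsin 1 t)^5 * (dsin 5 t) * (dsin 0 t)^3 - 15430357 * (dsin 1 t)^6
      * (dsin 2 t)^3 * (dsin 0 t)^2 - 1252745 * (dsin 1 t)^4 * (dsin 2 t)^3 * (dsin 0 t)^2 -
      7747848 * (dsin 1 t)^7 * (dsin 2 t) * (dsin 3 t) * (dsin 0 t)^2 - 967590 * (dsin 1 t)^5 *
      (dsin 2 t) * (dsin 3 t) * (dsin 0 t)^2 - 385200 * (dsin 1 t)^8 * (dsin 4 t) * (dsin 0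
      t)^2 - 73125 * (dsin 1 t)^6 * (dsin 4 t) * (dsin 0 t)^2 + 5645124 * (dsin 1 t)^8 * (dsin
      2 t)^2 * (dsin 0 t) + 741195 * (dsin 1 t)^6 * (dsin 2 t)^2 * (dsin 0 t) + 749700 * (dsin
      1 t)^9 * (dsin 3 t) * (dsin 0 t) + 143325 * (dsin 1 t)^7 * (dsin 3 t) * (dsin 0 t) -
      749700 * (dsin 1 t)^10 * (dsin 2 t) - 143325 * (dsin 1 t)^8 * (dsin 2 t))
      = (10331 / 8648640) * Real.sin t ^ 3 := by
  have hs : Real.sin t ≠ 0 := (Real.sin_pos_of_pos_of_lt_pi ht0 ht1).ne'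
  simp only [dsin_add_two, dsin_zero, dsin_one]
  rw [one_div_mul_eq_div, div_eq_iff (by positivity)]
  linear_combination (-2730 * Real.sin t ^ 9) * Real.sin_sq_add_cos_sq t
end

section
/- With H and h_n as defined, h_8 = 1/10080. -/
open Complex

/-- The recursively defined quantities `H n j α` from Chamseddine–Connes'
recursion for the coefficient of the highest order term in the heat
coefficients of the Robertson–Walker metric. -/
noncomputable def rwH : ℕ → ℕ → ℕ → ℂ
  | 1, 2, 1 => 3 * Complex.I / (2 * (Real.sqrt Real.pi : ℂ))
  | 1, 3, 1 => 3 * Complex.I / (2 * (Real.sqrt Real.pi : ℂ))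
  | 2, 2, 0 => 3 / (4 * (Real.sqrt Real.pi : ℂ))
  | 2, 3, 0 => 3 / (4 * (Real.sqrt Real.pi : ℂ))
  | 2, 3, 2 => -3 / (2 * (Real.sqrt Real.pi : ℂ))
  | 2, 4, 2 => -1 / (Real.sqrt Real.pi : ℂ)
  | n+3, j+2, α+1 =>
      (1 / ((j : ℂ) + 1)) * (rwH (n+1) (j+1) (α+1) + 2 * Complex.I * rwH (n+2) (j+1) α)
  | n+3, j+2, 0 => (1 / ((j : ℂ) + 1)) * rwH (n+1) (j+1) 0
  | _, _, _ => 0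

/-- The coefficient `h_n` of `a(t)^{n-1} a^{(n)}(t)` in the heat coefficient `a_n`. -/
noncomputable def rwh (n : ℕ) : ℂ :=
  ∑ j ∈ Finset.Icc (n / 2 + 1) (2 * n + 1), ∑ k ∈ Finset.range (j - n / 2),
    ((Real.Gamma ((k : ℝ) + 1 / 2) : ℂ)) * rwH n j (2 * k)


open scoped Nat

/-- The rational part of `rwH`: the number `q` with `rwH n j α = I ^ α / √π * q`. -/
def rwHRat : ℕ → ℕ → ℕ → ℚ
  | 1, 2, 1 => 3 / 2
  | 1, 3, 1 => 3 / 2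
  | 2, 2, 0 => 3 / 4
  | 2, 3, 0 => 3 / 4
  | 2, 3, 2 => 3 / 2
  | 2, 4, 2 => 1
  | n+3, j+2, α+1 =>
      (1 / ((j : ℚ) + 1)) * (rwHRat (n+1) (j+1) (α+1) + 2 * rwHRat (n+2) (j+1) α)
  | n+3, j+2, 0 => (1 / ((j : ℚ) + 1)) * rwHRat (n+1) (j+1) 0
  | _, _, _ => 0

lemma rwH_eq_rwHRat (n j α : ℕ) :
    rwH n j α = I ^ α / (Real.sqrt Real.pi : ℂ) * (rwHRat n j α : ℂ) := by
  fun_induction rwHRat n j α with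
  | case7 n j α ih₁ ih₂ =>
    rw [rwH, ih₁, ih₂, Nat.succ_eq_add_one]
    push_cast
    ring
  | case8 n j ih =>
    rw [rwH, ih]
    push_cast
    ring
  | case9 n j α => simp [rwH, *]
  | _ =>
    simp only [rwH, I_sq, pow_zero, pow_one]
    push_cast
    ring

lemma rwh_eq_rat_sum (n : ℕ) :
    rwh n = ((∑ j ∈ Finset.Icc (n / 2 + 1) (2 * n + 1), ∑ k ∈ Finset.range (j - n / 2),
      (-1) ^ k * ((2 * k - 1 : ℕ)‼ : ℚ) / 2 ^ k * rwHRat n j (2 * k) : ℚ) : ℂ) := by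
  have hπ : (Real.sqrt Real.pi : ℂ) ≠ 0 :=
    ofReal_ne_zero.mpr (Real.sqrt_pos.mpr Real.pi_pos).ne'
  rw [rwh]
  push_cast
  refine Finset.sum_congr rfl fun j _ => Finset.sum_congr rfl fun k _ => ?_
  rw [Real.Gamma_nat_add_half, rwH_eq_rwHRat, pow_mul, I_sq]
  push_cast
  field_simp

theorem rwh_eight : rwh 8 = 1 / 10080 := by
  have h : (∑ j ∈ Finset.Icc (8 / 2 + 1) (2 * 8 + 1), ∑ k ∈ Finset.range (j - 8 / 2),
      (-1) ^ k * ((2 * k - 1 : ℕ)‼ : ℚ) / 2 ^ k * rwHRat 8 j (2 * k)) = 1 / 10080 := by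
    decide +kernel
  rw [rwh_eq_rat_sum, h]
  norm_num
end

section
/- With H and h_n as defined, h_12 = 1/5765760 and h_14 = 1/172972800. -/
open Complex

/-- The natural numbers left after removing from `rwH n j α` the factor
`I ^ α / (4 * (j - 1)! * √π)`. -/
def rwNat : ℕ → ℕ → ℕ → ℕ
  | 1, 2, 1 => 6
  | 1, 3, 1 => 12
  | 2, 2, 0 => 3
  | 2, 3, 0 => 6
  | 2, 3, 2 => 12
  | 2, 4, 2 => 24
  | n+3, j+2, α+1 => rwNat (n+1) (j+1) (α+1) + 2 * rwNat (n+2) (j+1) α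
  | n+3, j+2, 0 => rwNat (n+1) (j+1) 0
  | _, _, _ => 0

theorem rwH_eq_rwNat (n j α : ℕ) :
    rwH n j α = Complex.I ^ α * (rwNat n j α : ℂ) /
      (4 * ((j - 1).factorial : ℂ) * (Real.sqrt Real.pi : ℂ)) := by
  fun_induction rwNat n j α with
  | case1 => simp [rwH]; ring
  | case2 => simp [rwH]; ring
  | case3 => simp [rwH]
  | case4 => simp [rwH]; ring
  | case5 => simp [rwH]; ring
  | case6 => simp [rwH, Nat.factorial]; ring
  | case7 n j α ih₁ ih₂ =>
    have hj : (j : ℂ) + 1 ≠ 0 := Nat.cast_add_one_ne_zero j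
    have hf : (j.factorial : ℂ) ≠ 0 := Nat.cast_ne_zero.2 j.factorial_ne_zero
    have hπ : (Real.sqrt Real.pi : ℂ) ≠ 0 :=
      Complex.ofReal_ne_zero.2 (Real.sqrt_pos.2 Real.pi_pos).ne'
    simp only [rwH, ih₁, ih₂, Nat.add_sub_cancel, Nat.factorial_succ,
      show j + 2 - 1 = j + 1 from rfl]
    push_cast
    field_simp
    ring
  | case8 n j ih =>
    have hj : (j : ℂ) + 1 ≠ 0 := Nat.cast_add_one_ne_zero j
    simp only [rwH, ih, Nat.add_sub_cancel, Nat.factorial_succ,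
      show j + 2 - 1 = j + 1 from rfl]
    push_cast
    field_simp
  | case9 n j α =>
    rw [rwH] <;> simp_all

theorem Gamma_mul_rwH_eq (n j k : ℕ) :
    (Real.Gamma ((k : ℝ) + 1 / 2) : ℂ) * rwH n j (2 * k) =
      (((-1) ^ k * ((2 * k - 1).doubleFactorial : ℚ) * (rwNat n j (2 * k) : ℚ) /
        (2 ^ k * (4 * ((j - 1).factorial : ℚ))) : ℚ) : ℂ) := by
  have hπ : (Real.sqrt Real.pi : ℂ) ≠ 0 :=
    Complex.ofReal_ne_zero.2 (Real.sqrt_pos.2 Real.pi_pos).ne'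
  rw [Real.Gamma_nat_add_half, rwH_eq_rwNat, pow_mul, Complex.I_sq]
  push_cast
  field_simp

theorem rwh_eq_ratCast (n : ℕ) :
    rwh n = ((∑ j ∈ Finset.Icc (n / 2 + 1) (2 * n + 1), ∑ k ∈ Finset.range (j - n / 2),
      ((-1) ^ k * ((2 * k - 1).doubleFactorial : ℚ) * (rwNat n j (2 * k) : ℚ) /
        (2 ^ k * (4 * ((j - 1).factorial : ℚ)))) : ℚ) : ℂ) := by
  simp only [rwh, Gamma_mul_rwH_eq, Rat.cast_sum]

theorem rwh_twelve_fourteen : rwh 12 = 1 / 5765760 ∧ rwh 14 = 1 / 172972800 := by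
  rw [rwh_eq_ratCast, rwh_eq_ratCast,
    show (1 / 5765760 : ℂ) = ((1 / 5765760 : ℚ) : ℂ) by norm_num,
    show (1 / 172972800 : ℂ) = ((1 / 172972800 : ℚ) : ℂ) by norm_num, Rat.cast_inj, Rat.cast_inj]
  decide +kernel
end

section
/- With H and h_n as defined, h_16 = 1/5881075200, h_18 = 1/223480857600 and h_20 = 1/9386196019200. -/
open Complex

/-- The integers `4 (j - 1)! √π i^{-α} H n j α`. -/
def rwHNat : ℕ → ℕ → ℕ → ℕ
  | 1, 2, 1 => 6
  | 1, 3, 1 => 12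
  | 2, 2, 0 => 3
  | 2, 3, 0 => 6
  | 2, 3, 2 => 12
  | 2, 4, 2 => 24
  | n+3, j+2, α+1 => rwHNat (n+1) (j+1) (α+1) + 2 * rwHNat (n+2) (j+1) α
  | n+3, j+2, 0 => rwHNat (n+1) (j+1) 0
  | _, _, _ => 0

lemma ofReal_sqrt_pi_ne_zero : (Real.sqrt Real.pi : ℂ) ≠ 0 :=
  Complex.ofReal_ne_zero.mpr (Real.sqrt_ne_zero'.mpr Real.pi_pos)

lemma rwH_eq (n j α : ℕ) :
    rwH n j α =
      I ^ α * (rwHNat n j α : ℂ) / (4 * ((j - 1).factorial : ℂ) * (Real.sqrt Real.pi : ℂ)) := by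
  have hpi := ofReal_sqrt_pi_ne_zero
  fun_induction rwHNat n j α with
  | case7 n j α ih₁ ih₂ =>
    have hfac : (j.factorial : ℂ) ≠ 0 := by exact_mod_cast j.factorial_ne_zero
    have hj : (j : ℂ) + 1 ≠ 0 := by exact_mod_cast j.succ_ne_zero
    rw [rwH, ih₁, ih₂]
    rw [show j + 2 - 1 = j + 1 from rfl, Nat.add_sub_cancel, Nat.factorial_succ]
    push_cast
    field_simp
    ring
  | case8 n j ih =>
    have hfac : (j.factorial : ℂ) ≠ 0 := by exact_mod_cast j.factorial_ne_zero
    have hj : (j : ℂ) + 1 ≠ 0 := by exact_mod_cast j.succ_ne_zero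
    rw [rwH, ih]
    rw [show j + 2 - 1 = j + 1 from rfl, Nat.add_sub_cancel, Nat.factorial_succ]
    push_cast
    field_simp
  | case9 =>
    rw [rwH] <;> simp_all
  | _ =>
    simp only [rwH, Nat.factorial]
    norm_num [I_sq]
    try field_simp
    try norm_num

/-- The coefficient `h_n` as a finite sum of rational numbers. -/
def rwhRat (n : ℕ) : ℚ :=
  ∑ j ∈ Finset.Icc (n / 2 + 1) (2 * n + 1), ∑ k ∈ Finset.range (j - n / 2),
    (-1) ^ k * ((2 * k - 1).doubleFactorial * rwHNat n j (2 * k) : ℕ) /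
      (4 * 2 ^ k * (j - 1).factorial : ℕ)

lemma rwh_eq_rwhRat (n : ℕ) : rwh n = (rwhRat n : ℂ) := by
  have hpi := ofReal_sqrt_pi_ne_zero
  simp only [rwh, rwhRat, Rat.cast_sum]
  refine Finset.sum_congr rfl fun j _ => Finset.sum_congr rfl fun k _ => ?_
  have hfac : ((j - 1).factorial : ℂ) ≠ 0 := by exact_mod_cast (j - 1).factorial_ne_zero
  rw [rwH_eq, Real.Gamma_nat_add_half, pow_mul, I_sq]
  push_cast
  field_simp

theorem rwh_sixteen_up : rwh 16 = 1 / 5881075200 ∧ rwh 18 = 1 / 223480857600 ∧ rwh 20 = 1 / 9386196019200 := by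
  have h₁ : rwhRat 16 = 1 / 5881075200 := by decide +kernel
  have h₂ : rwhRat 18 = 1 / 223480857600 := by decide +kernel
  have h₃ : rwhRat 20 = 1 / 9386196019200 := by decide +kernel
  simp only [rwh_eq_rwhRat, h₁, h₂, h₃]
  norm_num
end
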